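/- Let A be a nonempty set. (1) A ∩-closed Krasner algebra R on A is Galois closed (R = sInv Aut R) if and only if sInv Aut R_0 ⊆ R for every countable subset R_0 of R. (2) A set R of finitary relations on A is Galois closed if and only if R is ∩-closed and closed under all invariant operations with countable arity, i.e. R = ⟨R⟩_{ω-inv,∩}. (3) For every set Q of finitary relations on A, ⟨Q⟩_{ω-inv,∩} = sInv Aut Q. -/

import Mathlib

open FirstOrder

/-- A finitary relation on `A` of arity `m+1` (so all arities are ≥ 1). -/
def Rels (A : Type*) : Type _ := Σ m : ℕ, Set (Fin (m + 1) → A)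

/-- The image `g[ρ]` of a relation under a permutation. -/
def permImage {A : Type*} (g : Equiv.Perm A) {m : ℕ} (ρ : Set (Fin m → A)) :
    Set (Fin m → A) := (fun a => ⇑g ∘ a) '' ρ

/-- `Aut R`: permutations strongly preserving every relation in `R`. -/
def AutR {A : Type*} (R : Set (Rels A)) : Set (Equiv.Perm A) :=
  {g | ∀ ρ ∈ R, permImage g ρ.2 = ρ.2}

/-- `sInv G`: relations strongly invariant under every permutation in `G`. -/
def sInvG {A : Type*} (G : Set (Equiv.Perm A)) : Set (Rels A) :=
  {ρ | ∀ g ∈ G, permImage g ρ.2 = ρ.2}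

/-- The language with relation symbols `P i` of arity `k i`, for `i : Fin n`. -/
def relLang (n : ℕ) (k : Fin n → ℕ) : Language where
  Functions := fun _ => Empty
  Relations := fun m => {i : Fin n // k i = m}

/-- The structure on `A` interpreting `P i` as `ρ i`. -/
def relStruct {A : Type*} {n : ℕ} {k : Fin n → ℕ}
    (ρ : ∀ i : Fin n, Set (Fin (k i) → A)) : (relLang n k).Structure A where
  funMap := fun f _ => f.elim
  RelMap := fun {m} r x => (fun j => x (Fin.cast r.2 j)) ∈ ρ r.1

/-- The logical operation given by a first-order formula `φ` with `m` free
variables, applied to the relations `ρ i`. -/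
def logicalOp {A : Type*} {n : ℕ} {k : Fin n → ℕ}
    (ρ : ∀ i : Fin n, Set (Fin (k i) → A)) {m : ℕ}
    (φ : (relLang n k).Formula (Fin m)) : Set (Fin m → A) :=
  letI := relStruct ρ
  {a | φ.Realize a}

/-- `R` is closed under all logical operations (i.e. `R` is a Krasner algebra). -/
def KrasnerClosed {A : Type*} (R : Set (Rels A)) : Prop :=
  ∀ (n : ℕ) (k : Fin n → ℕ) (ρ : ∀ i : Fin n, Set (Fin (k i + 1) → A)),
    (∀ i, (⟨k i, ρ i⟩ : Rels A) ∈ R) →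
    ∀ (m : ℕ) (φ : (relLang n (fun i => k i + 1)).Formula (Fin (m + 1))),
      (⟨m, logicalOp ρ φ⟩ : Rels A) ∈ R

/-- `R` is ∩-closed: it contains each `A^m` and is closed under arbitrary
intersections of relations of equal arity. -/
def InterClosed {A : Type*} (R : Set (Rels A)) : Prop :=
  (∀ m : ℕ, (⟨m, Set.univ⟩ : Rels A) ∈ R) ∧
  ∀ (m : ℕ) (Q : Set (Set (Fin (m + 1) → A))),
    (∀ ρ ∈ Q, (⟨m, ρ⟩ : Rels A) ∈ R) → (⟨m, ⋂₀ Q⟩ : Rels A) ∈ R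

/-- An invariant operation with countable arity. -/
def OmInvariant {A : Type*} {k : ℕ → ℕ} {m : ℕ}
    (F : (∀ i : ℕ, Set (Fin (k i + 1) → A)) → Set (Fin (m + 1) → A)) : Prop :=
  ∀ (g : Equiv.Perm A) (ρ : ∀ i : ℕ, Set (Fin (k i + 1) → A)),
    F (fun i => permImage g (ρ i)) = permImage g (F ρ)

/-- `R` is closed under all invariant operations with countable arity. -/
def OmInvClosed {A : Type*} (R : Set (Rels A)) : Prop :=
  ∀ (k : ℕ → ℕ) (m : ℕ)
    (F : (∀ i : ℕ, Set (Fin (k i + 1) → A)) → Set (Fin (m + 1) → A)),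
    OmInvariant F → ∀ ρ : ∀ i : ℕ, Set (Fin (k i + 1) → A),
      (∀ i, (⟨k i, ρ i⟩ : Rels A) ∈ R) → (⟨m, F ρ⟩ : Rels A) ∈ R

/-- `⟨Q⟩_{ω-inv,∩}`: the least ∩-closed set containing `Q` and closed under all
invariant operations with countable arity. -/
def omInvInterClosure {A : Type*} (Q : Set (Rels A)) : Set (Rels A) :=
  ⋂₀ {R | Q ⊆ R ∧ OmInvClosed R ∧ InterClosed R}

theorem mem_permImage {A : Type*} (g : Equiv.Perm A) {m : ℕ} (ρ : Set (Fin m → A))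
    (c : Fin m → A) : c ∈ permImage g ρ ↔ (⇑g⁻¹ ∘ c) ∈ ρ := by
  constructor
  · rintro ⟨a, ha, rfl⟩
    have : (⇑g⁻¹ ∘ (fun a => ⇑g ∘ a) a) = a := by
      funext j; simp
    rw [this]; exact ha
  · intro h
    refine ⟨_, h, ?_⟩
    funext j; simp

theorem permImage_eq_iff {A : Type*} (g : Equiv.Perm A) {m : ℕ} (ρ : Set (Fin m → A)) :
    permImage g ρ = ρ ↔ ∀ a : Fin m → A, (⇑g ∘ a) ∈ ρ ↔ a ∈ ρ := by
  have e : ∀ a : Fin m → A, (⇑g⁻¹ ∘ (⇑g ∘ a)) = a := by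
    intro a; funext j; simp
  have e' : ∀ a : Fin m → A, (⇑g ∘ (⇑g⁻¹ ∘ a)) = a := by
    intro a; funext j; simp
  constructor
  · intro h a
    have h1 := mem_permImage g ρ (⇑g ∘ a)
    rw [h, e] at h1
    exact h1
  · intro h
    ext c
    rw [mem_permImage, ← h, e']

theorem permImage_mul {A : Type*} (g h : Equiv.Perm A) {m : ℕ} (ρ : Set (Fin m → A)) :
    permImage (g * h) ρ = permImage g (permImage h ρ) := by
  ext c
  simp only [mem_permImage, mul_inv_rev]
  rfl

theorem permImage_one {A : Type*} {m : ℕ} (ρ : Set (Fin m → A)) :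
    permImage 1 ρ = ρ := by
  ext c
  simp only [mem_permImage]
  rfl

def opC {A : Type*} {m : ℕ} (ρ : Set (Fin (m + 1) → A)) : Set (Fin (m + 1) → A) :=
  {c | ¬ c ∈ ρ}

def opL {A : Type*} {m : ℕ} (ρ ρ' : Set (Fin (m + 1) → A)) : Set (Fin ((m + 1 + m) + 1) → A) :=
  {c | ¬ ((fun j : Fin (m + 1) => c (Fin.castAdd (m + 1) j)) ∈ ρ ∧
      (fun j : Fin (m + 1) => c (Fin.natAdd (m + 1) j)) ∈ ρ')}

def ClC {A : Type*} (R : Set (Rels A)) : Prop :=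
  ∀ (m : ℕ) (ρ : Set (Fin (m + 1) → A)), (⟨m, ρ⟩ : Rels A) ∈ R → (⟨m, opC ρ⟩ : Rels A) ∈ R

def ClL {A : Type*} (R : Set (Rels A)) : Prop :=
  ∀ (m : ℕ) (ρ ρ' : Set (Fin (m + 1) → A)), (⟨m, ρ⟩ : Rels A) ∈ R → (⟨m, ρ'⟩ : Rels A) ∈ R →
    (⟨m + 1 + m, opL ρ ρ'⟩ : Rels A) ∈ R

theorem krasner_C {A : Type*} {R : Set (Rels A)} (h : KrasnerClosed R) : ClC R := by
  intro m ρ hρ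
  have := h 1 (fun _ => m) (fun _ => ρ) (fun _ => hρ) m
    (FirstOrder.Language.Relations.formula (L := relLang 1 (fun _ => m + 1)) (n := m + 1)
      (⟨0, rfl⟩ : {i : Fin 1 // m + 1 = m + 1}) (fun j => FirstOrder.Language.Term.var j)).not
  convert this using 2
  ext c
  simp only [opC, logicalOp, Set.mem_ofPred_eq, FirstOrder.Language.Formula.realize_not]
  rfl

theorem krasner_L {A : Type*} {R : Set (Rels A)} (h : KrasnerClosed R) : ClL R := by
  intro m ρ ρ' hρ hρ'
  have := h 2 (fun _ => m) (fun i => if i = 0 then ρ else ρ')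
    (fun i => by by_cases hi : i = 0 <;> simp [hi, hρ, hρ']) (m + 1 + m)
    ((FirstOrder.Language.Relations.formula (L := relLang 2 (fun _ => m + 1)) (n := m + 1)
      (⟨0, rfl⟩ : {i : Fin 2 // m + 1 = m + 1})
        (fun j => FirstOrder.Language.Term.var (Fin.castAdd (m + 1) j))) ⊓
     (FirstOrder.Language.Relations.formula (L := relLang 2 (fun _ => m + 1)) (n := m + 1)
      (⟨1, rfl⟩ : {i : Fin 2 // m + 1 = m + 1})
        (fun j => FirstOrder.Language.Term.var (Fin.natAdd (m + 1) j)))).not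
  convert this using 2
  ext c
  simp only [opL, logicalOp, Set.mem_ofPred_eq, FirstOrder.Language.Formula.realize_not,
    FirstOrder.Language.Formula.realize_inf]
  rfl

theorem om_C {A : Type*} {R : Set (Rels A)} (h : OmInvClosed R) : ClC R := by
  intro m ρ hρ
  refine h (fun _ => m) m (fun r => opC (r 0)) ?_ (fun _ => ρ) (fun _ => hρ)
  intro g r
  ext c
  simp only [opC, Set.mem_ofPred_eq, mem_permImage]

theorem om_L {A : Type*} {R : Set (Rels A)} (h : OmInvClosed R) : ClL R := by
  intro m ρ ρ' hρ hρ'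
  refine h (fun _ => m) (m + 1 + m) (fun r => opL (r 0) (r 1)) ?_
    (fun i => if i = 0 then ρ else ρ')
    (fun i => by by_cases hi : i = 0 <;> simp [hi, hρ, hρ'])
  intro g r
  ext c
  simp only [opL, Set.mem_ofPred_eq, mem_permImage]
  rfl

def Gam {A : Type*} (R : Set (Rels A)) {m : ℕ} (a : Fin (m + 1) → A) : Set (Fin (m + 1) → A) :=
  ⋂₀ {ρ | (⟨m, ρ⟩ : Rels A) ∈ R ∧ a ∈ ρ}

theorem mem_Gam {A : Type*} (R : Set (Rels A)) {m : ℕ} (a : Fin (m + 1) → A) : a ∈ Gam R a := by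
  rintro ρ ⟨_, h⟩; exact h

theorem Gam_eq {A : Type*} {R : Set (Rels A)} (hC : ClC R) {m : ℕ} {a b : Fin (m + 1) → A}
    (hb : b ∈ Gam R a) : Gam R b = Gam R a := by
  have key : ∀ ρ, (⟨m, ρ⟩ : Rels A) ∈ R → (b ∈ ρ ↔ a ∈ ρ) := by
    intro ρ hρ
    constructor
    · intro h
      by_contra hn
      exact hb (opC ρ) ⟨hC m ρ hρ, hn⟩ h
    · intro h
      exact hb ρ ⟨hρ, h⟩
  unfold Gam
  congr 1
  ext ρ
  constructor
  · rintro ⟨h1, h2⟩; exact ⟨h1, (key ρ h1).1 h2⟩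
  · rintro ⟨h1, h2⟩; exact ⟨h1, (key ρ h1).2 h2⟩

theorem Gam_mem {A : Type*} {R : Set (Rels A)} (hI : InterClosed R) {m : ℕ}
    (a : Fin (m + 1) → A) : (⟨m, Gam R a⟩ : Rels A) ∈ R :=
  hI.2 m _ (fun _ h => h.1)

def sig {A : Type*} (R : Set (Rels A)) (m : ℕ) : Set (Fin ((m + 1 + m) + 1) → A) :=
  {c | ¬ WellOrderingRel (Gam R (fun j : Fin (m + 1) => c (Fin.castAdd (m + 1) j)))
      (Gam R (fun j : Fin (m + 1) => c (Fin.natAdd (m + 1) j)))}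

theorem sig_mem {A : Type*} {R : Set (Rels A)} (hI : InterClosed R) (hC : ClC R) (hL : ClL R)
    (m : ℕ) : (⟨m + 1 + m, sig R m⟩ : Rels A) ∈ R := by
  have : sig R m = ⋂₀ {τ | ∃ a b : Fin (m + 1) → A, WellOrderingRel (Gam R a) (Gam R b) ∧
      τ = opL (Gam R a) (Gam R b)} := by
    ext c
    constructor
    · rintro hc τ ⟨a, b, hab, rfl⟩ ⟨h1, h2⟩
      apply hc
      rw [Gam_eq hC h1, Gam_eq hC h2]
      exact hab
    · intro h hc
      exact h _ ⟨_, _, hc, rfl⟩ ⟨mem_Gam R _, mem_Gam R _⟩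
  rw [this]
  refine hI.2 _ _ ?_
  rintro τ ⟨a, b, -, rfl⟩
  exact hL _ _ _ (Gam_mem hI a) (Gam_mem hI b)

theorem aut_sig {A : Type*} {R : Set (Rels A)} (g : Equiv.Perm A)
    (hg : ∀ m, permImage g (sig R m) = sig R m) : g ∈ AutR R := by
  have h1 : ∀ (m : ℕ) (a b : Fin (m + 1) → A),
      WellOrderingRel (Gam R (⇑g ∘ a)) (Gam R (⇑g ∘ b)) ↔
        WellOrderingRel (Gam R a) (Gam R b) := by
    intro m a b
    have := (permImage_eq_iff g _).1 (hg m) (Fin.append a b : Fin (m + 1 + (m + 1)) → A)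
    have t := not_iff_not.1 this
    simp only [Function.comp_apply, Fin.append_left, Fin.append_right] at t
    exact t
  have wo : ∀ m : ℕ, IsWellOrder (Set (Fin (m + 1) → A)) WellOrderingRel := fun m => inferInstance
  have h2 : ∀ (m : ℕ) (S : Set (Fin (m + 1) → A)) (a : Fin (m + 1) → A),
      Gam R a = S → Gam R (⇑g ∘ a) = Gam R a := by
    intro m S
    have wf : WellFounded (WellOrderingRel (α := Set (Fin (m + 1) → A))) :=
      IsWellFounded.wf
    induction S using wf.induction with
    | _ S ih =>
      rintro a rfl
      rcases trichotomous_of WellOrderingRel (Gam R (⇑g ∘ a)) (Gam R a) with h | h | h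
      · have e := ih _ h (⇑g ∘ a) rfl
        have := (h1 m _ _).2 h
        rw [e] at this
        exact absurd this (irrefl_of WellOrderingRel _)
      · exact h
      · have eb : (⇑g ∘ (⇑g⁻¹ ∘ a)) = a := by funext j; simp
        have l : WellOrderingRel (Gam R (⇑g⁻¹ ∘ a)) (Gam R a) := by
          rw [← h1, eb]; exact h
        have e := ih _ l _ rfl
        rw [eb] at e
        rw [← e] at l
        exact absurd l (irrefl_of WellOrderingRel _)
  rintro ⟨m, ρ⟩ hρ
  rw [permImage_eq_iff]
  intro a
  have e := h2 m _ a rfl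
  constructor
  · intro h
    have : a ∈ Gam R (⇑g ∘ a) := by rw [e]; exact mem_Gam R a
    exact this ρ ⟨hρ, h⟩
  · intro h
    have : (⇑g ∘ a) ∈ Gam R a := by rw [← e]; exact mem_Gam R _
    exact this ρ ⟨hρ, h⟩

theorem subset_sInv {A : Type*} (R : Set (Rels A)) : R ⊆ sInvG (AutR R) :=
  fun ρ hρ _ hg => hg ρ hρ

theorem sInv_mono {A : Type*} {Q R : Set (Rels A)} (h : Q ⊆ R) :
    sInvG (AutR Q) ⊆ sInvG (AutR R) :=
  fun _ hρ g hg => hρ g (fun σ hσ => hg σ (h hσ))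

theorem sInv_inter {A : Type*} (G : Set (Equiv.Perm A)) : InterClosed (sInvG G) := by
  constructor
  · intro m g _
    exact (permImage_eq_iff g _).2 (fun a => by simp)
  · intro m Q hQ g hg
    refine (permImage_eq_iff g _).2 (fun a => ?_)
    constructor
    · intro h ρ hρ
      exact ((permImage_eq_iff g _).1 (hQ ρ hρ g hg) a).1 (h ρ hρ)
    · intro h ρ hρ
      exact ((permImage_eq_iff g _).1 (hQ ρ hρ g hg) a).2 (h ρ hρ)

theorem sInv_om {A : Type*} (G : Set (Equiv.Perm A)) : OmInvClosed (sInvG G) := by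
  intro k m F hF ρ hρ g hg
  have := hF g ρ
  have e : (fun i => permImage g (ρ i)) = ρ := by
    funext i; exact hρ i g hg
  rw [e] at this
  exact this.symm

theorem om_countable {A : Type*} {R : Set (Rels A)} (hO : OmInvClosed R) (k : ℕ → ℕ)
    (σ : ∀ i : ℕ, Set (Fin (k i + 1) → A)) (hσ : ∀ i, (⟨k i, σ i⟩ : Rels A) ∈ R)
    (m : ℕ) (τ : Set (Fin (m + 1) → A))
    (hτ : ∀ g : Equiv.Perm A, (∀ i, permImage g (σ i) = σ i) → permImage g τ = τ) :
    (⟨m, τ⟩ : Rels A) ∈ R := by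
  have h := hO k m (fun ρ => {c | ∃ g : Equiv.Perm A, (∀ i, permImage g (σ i) = ρ i) ∧
    c ∈ permImage g τ}) ?_ σ hσ
  · convert h using 2
    ext c
    constructor
    · intro hc
      exact ⟨1, fun i => permImage_one _, by rw [permImage_one]; exact hc⟩
    · rintro ⟨g, hg, hc⟩
      rw [hτ g hg] at hc
      exact hc
  · intro h ρ
    ext c
    rw [mem_permImage]
    constructor
    · rintro ⟨g, hg, hc⟩
      refine ⟨h⁻¹ * g, fun i => ?_, ?_⟩
      · rw [permImage_mul, hg i, ← permImage_mul, inv_mul_cancel, permImage_one]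
      · rw [mem_permImage] at hc ⊢
        convert hc using 1
        funext j; simp
    · rintro ⟨g, hg, hc⟩
      refine ⟨h * g, fun i => ?_, ?_⟩
      · rw [permImage_mul, hg i]
      · rw [permImage_mul, mem_permImage]; exact hc

theorem part2 {A : Type*} (R : Set (Rels A)) :
    R = sInvG (AutR R) ↔ (InterClosed R ∧ OmInvClosed R) := by
  constructor
  · intro h
    rw [h]
    exact ⟨sInv_inter _, sInv_om _⟩
  · rintro ⟨hI, hO⟩
    refine Set.Subset.antisymm (subset_sInv R) ?_
    rintro ⟨m, τ⟩ hτ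
    exact om_countable hO (fun i => i + 1 + i) (fun i => sig R i)
      (fun i => sig_mem hI (om_C hO) (om_L hO) i) m τ (fun g hg => hτ g (aut_sig g hg))

/-- (1) A ∩-closed Krasner algebra `R` is Galois closed iff
`sInv Aut R₀ ⊆ R` for every countable `R₀ ⊆ R`.  (2) `R` is Galois closed iff
`R` is ∩-closed and closed under all invariant operations with countable
arity.  (3) `⟨Q⟩_{ω-inv,∩} = sInv Aut Q` for every `Q`. -/
theorem stmt19 {A : Type*} [Nonempty A] :
    (∀ R : Set (Rels A), KrasnerClosed R → InterClosed R →
      (R = sInvG (AutR R) ↔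
        ∀ R₀ : Set (Rels A), R₀ ⊆ R → R₀.Countable → sInvG (AutR R₀) ⊆ R)) ∧
    (∀ R : Set (Rels A),
      R = sInvG (AutR R) ↔ (InterClosed R ∧ OmInvClosed R)) ∧
    (∀ Q : Set (Rels A), omInvInterClosure Q = sInvG (AutR Q)) := by
  refine ⟨?_, part2, ?_⟩
  · intro R hK hI
    constructor
    · intro h R₀ hs _
      rw [h]
      exact sInv_mono hs
    · intro h
      refine Set.Subset.antisymm (subset_sInv R) ?_
      have := h (Set.range fun m : ℕ => (⟨m + 1 + m, sig R m⟩ : Rels A))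
        (by
          rintro _ ⟨m, rfl⟩
          exact sig_mem hI (krasner_C hK) (krasner_L hK) m) (Set.countable_range _)
      refine Set.Subset.trans ?_ this
      intro ρ hρ g hg
      exact hρ g (aut_sig g (fun m => hg _ ⟨m, rfl⟩))
  · intro Q
    refine Set.Subset.antisymm ?_ ?_
    · exact Set.sInter_subset_of_mem ⟨subset_sInv Q, sInv_om _, sInv_inter _⟩
    · rintro ρ hρ R ⟨hQ, hO, hI⟩
      rw [(part2 R).2 ⟨hI, hO⟩]
      exact sInv_mono hQ hρ
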